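/- arXiv:2303.10363 — 3 statements merged into one kernel-verified Lean document; each statement's English description precedes it below -/
import Mathlib

section
/- The set of bijections of the binary Cantor space C induced by order-preserving codes contains the identity map and is closed under composition and under taking inverses; hence it is a subgroup of the group of all bijections of C. (This subgroup is the realization of Thompson's group F.) -/
open Set MeasureTheory Filter Topology

/-- The binary Cantor space. -/
abbrev CantorC : Type := ℕ → Bool

/-- Finite binary words. -/
abbrev BWord : Type := List Bool

/-- Prepend a finite word to an infinite binary sequence. -/
def wordApp (w : BWord) (x : CantorC) : CantorC := fun n =>
  if h : n < w.length then w.get ⟨n, h⟩ else x (n - w.length)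

/-- The cylinder of sequences beginning with the word `w`. -/
def cyl (w : BWord) : Set CantorC := Set.range (wordApp w)

/-- `J` is a code: both the α-cylinders and the β-cylinders form a partition of the
Cantor space (every point lies in the cylinder of exactly one pair). -/
def IsCode (J : Finset (BWord × BWord)) : Prop :=
  (∀ x : CantorC, ∃! p : BWord × BWord, p ∈ J ∧ x ∈ cyl p.1) ∧
  (∀ x : CantorC, ∃! p : BWord × BWord, p ∈ J ∧ x ∈ cyl p.2)

/-- `J` is order preserving: α ≺ α' lexicographically iff β ≺ β' lexicographically. -/
def OrdPres (J : Finset (BWord × BWord)) : Prop :=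
  ∀ p ∈ J, ∀ q ∈ J, (List.Lex (· < ·) p.1 q.1 ↔ List.Lex (· < ·) p.2 q.2)

/-- The bijection `g` is induced by the code `J` : it maps `β·x` to `α·x`. -/
def InducedBy (J : Finset (BWord × BWord)) (g : Equiv.Perm CantorC) : Prop :=
  ∀ p ∈ J, ∀ x : CantorC, g (wordApp p.2 x) = wordApp p.1 x

/-- `J` is an order-preserving code inducing the bijection `g`. -/
def IsCodeFor (J : Finset (BWord × BWord)) (g : Equiv.Perm CantorC) : Prop :=
  IsCode J ∧ OrdPres J ∧ InducedBy J g

/-- Membership in (the realization on the Cantor space of) Thompson's group `F`. -/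
def InF (g : Equiv.Perm CantorC) : Prop := ∃ J, IsCodeFor J g

/-- The pair `(α, β)` has `|α| ≡ |β| (mod 2)`. -/
def EvenPair (p : BWord × BWord) : Prop := p.1.length % 2 = p.2.length % 2

/-- Membership in the subgroup `H₂` : some order-preserving code for `g` has all
pairs of even length difference. -/
def InH2 (g : Equiv.Perm CantorC) : Prop :=
  ∃ J, IsCodeFor J g ∧ ∀ p ∈ J, EvenPair p

/-- The union of the α-cylinders over pairs of even length difference. -/
def pSet (J : Finset (BWord × BWord)) : Set CantorC :=
  {x | ∃ p ∈ J, EvenPair p ∧ x ∈ cyl p.1}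

/-- The union of the β-cylinders over pairs of even length difference. -/
def eSet (J : Finset (BWord × BWord)) : Set CantorC :=
  {x | ∃ p ∈ J, EvenPair p ∧ x ∈ cyl p.2}

/-- `p_f` : for `f ∈ F` this equals `pSet J` for any (equivalently, every)
order-preserving code `J` for `f`. -/
def pF (g : Equiv.Perm CantorC) : Set CantorC :=
  ⋃ J ∈ {J : Finset (BWord × BWord) | IsCodeFor J g}, pSet J

/-- `E_f` : for `f ∈ F` this equals `eSet J` for any (equivalently, every)
order-preserving code `J` for `f`. -/
def EF (g : Equiv.Perm CantorC) : Set CantorC :=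
  ⋃ J ∈ {J : Finset (BWord × BWord) | IsCodeFor J g}, eSet J

/-- `Ω₂ = {p_f : f ∈ F}`. -/
def Omega2 : Set (Set CantorC) := {p | ∃ g, InF g ∧ pF g = p}

/-- The action `f · p = f(p ∩ E_f) ∪ f((C ∖ p) ∩ (C ∖ E_f))`. -/
def actF (g : Equiv.Perm CantorC) (p : Set CantorC) : Set CantorC :=
  g '' (p ∩ EF g) ∪ g '' (pᶜ ∩ (EF g)ᶜ)

open Classical in
/-- `T(p)` as a Boolean-valued characteristic function: `T(p) w = true` iff the
cylinder of `w` meets `p`. -/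
noncomputable def Tb (p : Set CantorC) : BWord → Bool :=
  fun w => if (cyl w ∩ p).Nonempty then true else false

/-- The embedding `p ↦ (T(p), T(C ∖ p))`. -/
noncomputable def embedT (p : Set CantorC) : (BWord → Bool) × (BWord → Bool) :=
  (Tb p, Tb pᶜ)

/-- `Ω̄₂` : the closure of the image of `Ω₂` under the embedding. -/
noncomputable def OmegaBar : Set ((BWord → Bool) × (BWord → Bool)) :=
  closure (embedT '' Omega2)

theorem wordApp_nil (x : CantorC) : wordApp [] x = x := by
  funext n; simp [wordApp]

theorem wordApp_cons_zero (c : Bool) (u : BWord) (x : CantorC) : wordApp (c :: u) x 0 = c := by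
  simp [wordApp]

theorem wordApp_cons_succ (c : Bool) (u : BWord) (x : CantorC) (n : ℕ) :
    wordApp (c :: u) x (n + 1) = wordApp u x n := by
  simp [wordApp]

theorem wordApp_cons_eq_iff {c d : Bool} {u v : BWord} {x y : CantorC} :
    wordApp (c :: u) x = wordApp (d :: v) y ↔ c = d ∧ wordApp u x = wordApp v y := by
  constructor
  · intro h
    refine ⟨by simpa [wordApp_cons_zero] using congrFun h 0, funext fun n => ?_⟩
    simpa [wordApp_cons_succ] using congrFun h (n + 1)
  · rintro ⟨rfl, h⟩
    funext n
    cases n with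
    | zero => simp [wordApp_cons_zero]
    | succ n => simp [wordApp_cons_succ, h]

theorem wordApp_append (u v : BWord) (x : CantorC) :
    wordApp (u ++ v) x = wordApp u (wordApp v x) := by
  induction u with
  | nil => simp [wordApp_nil]
  | cons c u ih => simp [wordApp_cons_eq_iff, ih]

theorem exists_wordApp_eq (N : ℕ) (x : CantorC) :
    ∃ w : BWord, w.length = N ∧ ∃ y, wordApp w y = x := by
  induction N generalizing x with
  | zero => exact ⟨[], rfl, x, wordApp_nil x⟩
  | succ N ih =>
    obtain ⟨w, hw, y, hy⟩ := ih fun n => x (n + 1)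
    refine ⟨x 0 :: w, by simp [hw], y, funext fun n => ?_⟩
    cases n with
    | zero => simp [wordApp_cons_zero]
    | succ n => simp [wordApp_cons_succ, hy]

theorem prefix_of_wordApp_eq {u v : BWord} {x y : CantorC} (h : wordApp u x = wordApp v y)
    (hl : u.length ≤ v.length) : u <+: v := by
  induction u generalizing v with
  | nil => exact List.nil_prefix
  | cons c u ih =>
    cases v with
    | nil => simp at hl
    | cons d v =>
      obtain ⟨hcd, huv⟩ := wordApp_cons_eq_iff.1 h
      exact List.cons_prefix_cons.2 ⟨hcd, ih huv (by simpa using hl)⟩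

/-- The strict lexicographic order on the Cantor space. -/
def SeqLt (x y : CantorC) : Prop := ∃ n, (∀ m < n, x m = y m) ∧ x n < y n

theorem seqLt_wordApp_cons_iff {c d : Bool} {u v : BWord} {x y : CantorC} :
    SeqLt (wordApp (c :: u) x) (wordApp (d :: v) y) ↔
      c < d ∨ c = d ∧ SeqLt (wordApp u x) (wordApp v y) := by
  constructor
  · rintro ⟨n, h, hn⟩
    cases n with
    | zero => exact Or.inl (by simpa [wordApp_cons_zero] using hn)
    | succ n =>
      refine Or.inr ⟨by simpa [wordApp_cons_zero] using h 0 (by omega), n, fun m hm => ?_, ?_⟩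
      · simpa [wordApp_cons_succ] using h (m + 1) (by omega)
      · simpa [wordApp_cons_succ] using hn
  · rintro (h | ⟨rfl, n, h, hn⟩)
    · exact ⟨0, by simp, by simpa [wordApp_cons_zero] using h⟩
    · refine ⟨n + 1, fun m hm => ?_, by simpa [wordApp_cons_succ] using hn⟩
      cases m with
      | zero => simp [wordApp_cons_zero]
      | succ m => simpa [wordApp_cons_succ] using h m (by omega)

theorem seqLt_wordApp_iff (w : BWord) (x y : CantorC) :
    SeqLt (wordApp w x) (wordApp w y) ↔ SeqLt x y := by
  induction w with
  | nil => simp [wordApp_nil]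
  | cons c w ih => simp [seqLt_wordApp_cons_iff, ih]

theorem lex_iff_seqLt {u v : BWord} (h : Disjoint (cyl u) (cyl v)) (x y : CantorC) :
    List.Lex (· < ·) u v ↔ SeqLt (wordApp u x) (wordApp v y) := by
  have h' : ∀ a b, wordApp u a ≠ wordApp v b := fun a b hab =>
    Set.disjoint_left.1 h ⟨a, rfl⟩ ⟨b, hab.symm⟩
  clear h
  induction u generalizing v with
  | nil => exact absurd (wordApp_nil _) (h' (wordApp v y) y)
  | cons c u ih =>
    cases v with
    | nil => exact absurd (wordApp_nil _).symm (h' x (wordApp (c :: u) x))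
    | cons d v =>
      rw [seqLt_wordApp_cons_iff, List.cons_lex_cons_iff]
      refine or_congr_right (and_congr_right ?_)
      rintro rfl
      exact ih fun a b hab => h' a b (wordApp_cons_eq_iff.2 ⟨rfl, hab⟩)

theorem IsCode.disjoint_fst {J : Finset (BWord × BWord)} (hJ : IsCode J) {p q : BWord × BWord}
    (hp : p ∈ J) (hq : q ∈ J) (hne : p ≠ q) : Disjoint (cyl p.1) (cyl q.1) :=
  Set.disjoint_left.2 fun x hx hy => hne ((hJ.1 x).unique ⟨hp, hx⟩ ⟨hq, hy⟩)

theorem IsCode.disjoint_snd {J : Finset (BWord × BWord)} (hJ : IsCode J) {p q : BWord × BWord}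
    (hp : p ∈ J) (hq : q ∈ J) (hne : p ≠ q) : Disjoint (cyl p.2) (cyl q.2) :=
  Set.disjoint_left.2 fun x hx hy => hne ((hJ.2 x).unique ⟨hp, hx⟩ ⟨hq, hy⟩)

/-- For a code inducing `g`, preserving the order of words means that `g` preserves the order of
the Cantor space. -/
theorem ordPres_iff {J : Finset (BWord × BWord)} {g : Equiv.Perm CantorC} (hJ : IsCode J)
    (hg : InducedBy J g) : OrdPres J ↔ ∀ x y, SeqLt (g x) (g y) ↔ SeqLt x y := by
  constructor
  · intro ho x y
    obtain ⟨p, ⟨hp, a, rfl⟩, -⟩ := hJ.2 x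
    obtain ⟨q, ⟨hq, b, rfl⟩, -⟩ := hJ.2 y
    rw [hg p hp, hg q hq]
    by_cases hpq : p = q
    · subst hpq
      rw [seqLt_wordApp_iff, seqLt_wordApp_iff]
    · rw [← lex_iff_seqLt (hJ.disjoint_fst hp hq hpq), ← lex_iff_seqLt (hJ.disjoint_snd hp hq hpq)]
      exact ho p hp q hq
  · intro hm p hp q hq
    by_cases hpq : p = q
    · subst hpq
      have hirr : ∀ u : BWord, ¬ List.Lex (· < ·) u u := fun u => lt_irrefl u
      exact iff_of_false (hirr _) (hirr _)
    · let z : CantorC := fun _ => false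
      rw [lex_iff_seqLt (hJ.disjoint_fst hp hq hpq) z z,
        lex_iff_seqLt (hJ.disjoint_snd hp hq hpq) z z, ← hg p hp, ← hg q hq, hm]

/-- `g` acts by a change of prefix on each cylinder of a word of length at least `N`. -/
def PrefixMapAt (N : ℕ) (g : Equiv.Perm CantorC) : Prop :=
  ∀ β : BWord, N ≤ β.length → ∃ α : BWord, ∀ x, g (wordApp β x) = wordApp α x

theorem PrefixMapAt.mul {M N : ℕ} {f g : Equiv.Perm CantorC} (hf : PrefixMapAt M f)
    (hg : PrefixMapAt N g) : PrefixMapAt (N + M) (f * g) := by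
  intro β hβ
  obtain ⟨α, hα⟩ := hg (β.take N) (by simp; omega)
  obtain ⟨γ, hγ⟩ := hf (α ++ β.drop N) (by simp; omega)
  refine ⟨γ, fun x => ?_⟩
  rw [← hγ, wordApp_append, ← hα, ← wordApp_append, List.take_append_drop, Equiv.Perm.mul_apply]

theorem exists_prefixMapAt {J : Finset (BWord × BWord)} {g : Equiv.Perm CantorC} (hJ : IsCode J)
    (hg : InducedBy J g) : ∃ N, PrefixMapAt N g := by
  refine ⟨J.sup fun p => p.2.length, fun β hβ => ?_⟩
  obtain ⟨p, ⟨hp, a, ha⟩, -⟩ := hJ.2 (wordApp β fun _ => false)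
  obtain ⟨t, rfl⟩ := prefix_of_wordApp_eq ha
    ((Finset.le_sup (f := fun p : BWord × BWord => p.2.length) hp).trans hβ)
  exact ⟨p.1 ++ t, fun x => by rw [wordApp_append, wordApp_append, hg p hp]⟩

theorem PrefixMapAt.exists_isCode {N : ℕ} {g : Equiv.Perm CantorC} (h : PrefixMapAt N g) :
    ∃ J, IsCode J ∧ InducedBy J g := by
  classical
  choose! α hα using h
  let J := (List.finite_length_eq Bool N).toFinset.image fun β => (α β, β)
  have hJ : ∀ p : BWord × BWord, p ∈ J ↔ p.2.length = N ∧ p.1 = α p.2 := by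
    rintro ⟨a, b⟩
    simp only [J, Finset.mem_image, Set.Finite.mem_toFinset, Set.mem_ofPred_eq, Prod.mk.injEq]
    constructor
    · rintro ⟨β, hβ, rfl, rfl⟩
      exact ⟨hβ, rfl⟩
    · rintro ⟨hb, rfl⟩
      exact ⟨b, hb, rfl, rfl⟩
  have hind : InducedBy J g := by
    intro p hp x
    obtain ⟨hl, he⟩ := (hJ p).1 hp
    rw [he, hα _ hl.ge]
  have hsnd : ∀ x : CantorC, ∃! p : BWord × BWord, p ∈ J ∧ x ∈ cyl p.2 := by
    intro x
    obtain ⟨w, hw, y, rfl⟩ := exists_wordApp_eq N x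
    refine ⟨(α w, w), ⟨(hJ _).2 ⟨hw, rfl⟩, y, rfl⟩, ?_⟩
    rintro ⟨a, b⟩ ⟨hp, z, hz⟩
    obtain ⟨hl, he⟩ := (hJ _).1 hp
    dsimp only at hl he hz
    have hlen : b.length = w.length := hl.trans hw.symm
    obtain rfl := (prefix_of_wordApp_eq hz hlen.le).eq_of_length hlen
    rw [he]
  have hcyl : ∀ p ∈ J, ∀ x, x ∈ cyl p.1 ↔ g.symm x ∈ cyl p.2 := by
    intro p hp x
    refine exists_congr fun a => ?_
    rw [← hind p hp, Equiv.eq_symm_apply]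
  refine ⟨J, ⟨fun x => ?_, hsnd⟩, hind⟩
  refine (existsUnique_congr fun p => and_congr_right fun hp => hcyl p hp x).2 (hsnd (g.symm x))

theorem inF_iff {g : Equiv.Perm CantorC} :
    InF g ↔ (∃ N, PrefixMapAt N g) ∧ ∀ x y, SeqLt (g x) (g y) ↔ SeqLt x y := by
  constructor
  · rintro ⟨J, hJ, ho, hg⟩
    exact ⟨exists_prefixMapAt hJ hg, (ordPres_iff hJ hg).1 ho⟩
  · rintro ⟨⟨N, hN⟩, hm⟩
    obtain ⟨J, hJ, hg⟩ := hN.exists_isCode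
    exact ⟨J, hJ, (ordPres_iff hJ hg).2 hm, hg⟩

theorem inF_one : InF 1 :=
  inF_iff.2 ⟨⟨0, fun β _ => ⟨β, fun _ => rfl⟩⟩, fun _ _ => Iff.rfl⟩

theorem InF.mul {f g : Equiv.Perm CantorC} (hf : InF f) (hg : InF g) : InF (f * g) := by
  obtain ⟨⟨M, hM⟩, hf⟩ := inF_iff.1 hf
  obtain ⟨⟨N, hN⟩, hg⟩ := inF_iff.1 hg
  exact inF_iff.2 ⟨⟨N + M, hM.mul hN⟩, fun x y => (hf _ _).trans (hg x y)⟩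

theorem InF.inv {f : Equiv.Perm CantorC} (hf : InF f) : InF f⁻¹ := by
  classical
  obtain ⟨J, hJ, ho, hf⟩ := hf
  let e := Equiv.prodComm BWord BWord
  have hmem : ∀ p, p ∈ J.map e.toEmbedding ↔ e p ∈ J := fun p => Finset.mem_map_equiv
  refine ⟨J.map e.toEmbedding, ⟨fun x => ?_, fun x => ?_⟩, fun p hp q hq => ?_, fun p hp x => ?_⟩
  · exact (e.existsUnique_congr fun {p} => and_congr_left fun _ => hmem p).2 (hJ.2 x)
  · exact (e.existsUnique_congr fun {p} => and_congr_left fun _ => hmem p).2 (hJ.1 x)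
  · exact (ho _ ((hmem p).1 hp) _ ((hmem q).1 hq)).symm
  · rw [Equiv.Perm.inv_eq_iff_eq]
    exact (hf _ ((hmem p).1 hp) x).symm

/-- The set of bijections of the Cantor space induced by order-preserving
codes contains the identity, is closed under composition and inverses, and hence is
(the carrier of) a subgroup of the group of all bijections. -/
theorem stmt0 :
    InF (1 : Equiv.Perm CantorC) ∧
    (∀ f g : Equiv.Perm CantorC, InF f → InF g → InF (f * g)) ∧
    (∀ f : Equiv.Perm CantorC, InF f → InF f⁻¹) ∧
    ∃ G : Subgroup (Equiv.Perm CantorC), (G : Set (Equiv.Perm CantorC)) = {g | InF g} :=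
  ⟨inF_one, fun _ _ => InF.mul, fun _ => InF.inv,
    { carrier := {g | InF g}
      one_mem' := inF_one
      mul_mem' := InF.mul
      inv_mem' := InF.inv }, rfl⟩
end

section
/- For every element f of Thompson's group F and every order-preserving code J with g_J = f, there exists a pair (α, β) ∈ J with |α| ≡ |β| (mod 2). (Equivalently, in the paper's notation, f₀ ≠ 0 for every f ∈ F.) -/
open Set MeasureTheory Filter Topology

theorem mem_cyl_iff (w : BWord) (x : CantorC) :
    x ∈ cyl w ↔ ∀ (i : ℕ) (h : i < w.length), x i = w[i] := by
  constructor
  · rintro ⟨y, rfl⟩ i h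
    simp [wordApp, h]
  · intro hx
    refine ⟨fun n => x (n + w.length), funext fun n => ?_⟩
    by_cases h : n < w.length
    · simp [wordApp, h, hx n h]
    · simp [wordApp, h, Nat.sub_add_cancel (not_lt.mp h)]

/-- The number of words of length `N` with a given prefix. -/
theorem card_filter_prefix (w : BWord) (N : ℕ) (hN : w.length ≤ N) :
    (Finset.univ.filter fun v : Fin N → Bool =>
      ∀ (i : Fin N) (h : (i : ℕ) < w.length), v i = w[(i : ℕ)]).card
      = 2 ^ (N - w.length) := by
  have key : (Finset.univ.filter fun v : Fin N → Bool =>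
      ∀ (i : Fin N) (h : (i : ℕ) < w.length), v i = w[(i : ℕ)]) =
      Fintype.piFinset fun i : Fin N =>
        if h : (i : ℕ) < w.length then {w[(i : ℕ)]} else Finset.univ := by
    ext v
    simp only [Finset.mem_filter, Finset.mem_univ, true_and, Fintype.mem_piFinset]
    refine forall_congr' fun i => ?_
    by_cases h : (i : ℕ) < w.length <;> simp [h]
  have hcard (i : Fin N) :
      (if h : (i : ℕ) < w.length then {w[(i : ℕ)]} else Finset.univ : Finset Bool).card
        = if (i : ℕ) < w.length then 1 else 2 := by
    split_ifs <;> simp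
  rw [key, Fintype.card_piFinset, Finset.prod_congr rfl fun i _ => hcard i,
    Fin.prod_univ_eq_prod_range (fun i => if i < w.length then 1 else 2) N,
    ← Finset.prod_range_mul_prod_Ico _ hN]
  rw [Finset.prod_eq_one fun i hi => if_pos (Finset.mem_range.mp hi),
    Finset.prod_congr rfl fun i hi => if_neg (not_lt.mpr (Finset.mem_Ico.mp hi).1)]
  simp

/-- The Kraft equality for a finite partition of the Cantor space into cylinders. -/
theorem sum_two_pow_sub_length {ι : Type*} (S : Finset ι) (w : ι → BWord) (N : ℕ)
    (hN : ∀ p ∈ S, (w p).length ≤ N)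
    (hS : ∀ x : CantorC, ∃! p, p ∈ S ∧ x ∈ cyl (w p)) :
    ∑ p ∈ S, 2 ^ (N - (w p).length) = 2 ^ N := by
  have hmem (p : ι) (hp : p ∈ S) (v : Fin N → Bool) :
      (fun n => if h : n < N then v ⟨n, h⟩ else false) ∈ cyl (w p) ↔
        ∀ (i : Fin N) (h : (i : ℕ) < (w p).length), v i = (w p)[(i : ℕ)] := by
    rw [mem_cyl_iff]
    constructor
    · intro H i h
      simpa using H i h
    · intro H i h
      have hi : i < N := h.trans_le (hN p hp)
      simpa [hi] using H ⟨i, hi⟩ h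
  rw [← Finset.sum_congr rfl fun p hp => card_filter_prefix (w p) N (hN p hp)]
  simp only [Finset.card_filter]
  rw [Finset.sum_comm]
  have hone (v : Fin N → Bool) : (∑ p ∈ S,
      if ∀ (i : Fin N) (h : (i : ℕ) < (w p).length), v i = (w p)[(i : ℕ)] then 1 else 0)
        = 1 := by
    obtain ⟨p, ⟨hp, hv⟩, huniq⟩ := hS fun n => if h : n < N then v ⟨n, h⟩ else false
    rw [Finset.sum_eq_single_of_mem p hp, if_pos ((hmem p hp v).mp hv)]
    intro q hq hqp
    exact if_neg fun H => hqp (huniq q ⟨hq, (hmem q hq v).mpr H⟩)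
  simp [hone]

theorem two_pow_eq_neg_of_odd_add {a b : ℕ} (h : Odd (a + b)) :
    (2 : ZMod 3) ^ a = -2 ^ b := by
  have h2 : (2 : ZMod 3) = -1 := by decide
  rw [h2]
  rcases Nat.even_or_odd a with ha | ha
  · rw [ha.neg_one_pow, ((Nat.odd_add'.mp h).mpr ha).neg_one_pow, neg_neg]
  · rw [ha.neg_one_pow, ((Nat.odd_add.mp h).mp ha).neg_one_pow]

/-- every order-preserving code for an element of `F` contains a pair
`(α, β)` with `|α| ≡ |β| (mod 2)` (i.e. `f₀ ≠ 0`). -/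
theorem stmt1 (g : Equiv.Perm CantorC) (J : Finset (BWord × BWord))
    (hJ : IsCodeFor J g) :
    ∃ p ∈ J, EvenPair p := by
  by_contra! hodd
  set N := J.sup fun p => p.1.length + p.2.length
  have hN (p) (hp : p ∈ J) : p.1.length + p.2.length ≤ N :=
    Finset.le_sup (f := fun p : BWord × BWord => p.1.length + p.2.length) hp
  have hα := sum_two_pow_sub_length J Prod.fst N
    (fun p hp => le_trans (Nat.le_add_right _ _) (hN p hp)) hJ.1.1
  have hβ := sum_two_pow_sub_length J Prod.snd N
    (fun p hp => le_trans (Nat.le_add_left _ _) (hN p hp)) hJ.1.2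
  apply_fun (Nat.cast : ℕ → ZMod 3) at hα hβ
  push_cast at hα hβ
  have hneg (p) (hp : p ∈ J) :
      (2 : ZMod 3) ^ (N - p.1.length) = -2 ^ (N - p.2.length) := by
    refine two_pow_eq_neg_of_odd_add ?_
    have h₁ := hN p hp
    have h₂ := hodd p hp
    rw [EvenPair] at h₂
    rw [Nat.odd_iff]
    omega
  rw [Finset.sum_congr rfl hneg, Finset.sum_neg_distrib, hβ] at hα
  have hself : ∀ a : ZMod 3, -a = a → a = 0 := by decide
  exact pow_ne_zero N (by decide : (2 : ZMod 3) ≠ 0) (hself _ hα)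
end

section
/- If J and K are order-preserving codes inducing the same bijection of C, i.e. g_J = g_K, then ⋃{C_α : (α, β) ∈ J with |α| ≡ |β| (mod 2)} = ⋃{C_α : (α, β) ∈ K with |α| ≡ |β| (mod 2)}, and likewise ⋃{C_β : (α, β) ∈ J with |α| ≡ |β| (mod 2)} = ⋃{C_β : (α, β) ∈ K with |α| ≡ |β| (mod 2)}. Hence the sets p_f and E_f depend only on the element f of F, not on the chosen order-preserving code. -/
open Set MeasureTheory Filter Topology

theorem wordApp_of_lt {w : BWord} {x : CantorC} {n : ℕ} (h : n < w.length) :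
    wordApp w x n = w[n] := by
  simp [wordApp, h]

theorem wordApp_of_le {w : BWord} {x : CantorC} {n : ℕ} (h : w.length ≤ n) :
    wordApp w x n = x (n - w.length) := by
  simp [wordApp, Nat.not_lt.mpr h]

theorem wordApp_shift_of_mem_cyl {w : BWord} {x : CantorC} (hx : x ∈ cyl w) :
    wordApp w (fun n => x (n + w.length)) = x := by
  obtain ⟨z, rfl⟩ := hx
  funext n
  rcases lt_or_ge n w.length with h | h
  · rw [wordApp_of_lt h, wordApp_of_lt h]
  · rw [wordApp_of_le h, Nat.sub_add_cancel h]

/-- If `x` begins with both `u` and `v`, and `u` is not longer than `v`, then every sequence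
beginning with `v` begins with `u`. -/
theorem wordApp_mem_cyl_of_length_le {u v : BWord} {x : CantorC} (hu : x ∈ cyl u)
    (hv : x ∈ cyl v) (hle : u.length ≤ v.length) (y : CantorC) : wordApp v y ∈ cyl u := by
  obtain ⟨a, ha⟩ := hu
  obtain ⟨b, rfl⟩ := hv
  refine ⟨fun n => wordApp v y (n + u.length), funext fun n => ?_⟩
  rcases lt_or_ge n u.length with h | h
  · have hn := congrFun ha n
    rw [wordApp_of_lt h, wordApp_of_lt (h.trans_le hle)] at hn
    rw [wordApp_of_lt h, wordApp_of_lt (h.trans_le hle), hn]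
  · rw [wordApp_of_le h, Nat.sub_add_cancel h]

/-- Two pairs acting compatibly with the same map on overlapping cylinders have the same
length difference. -/
theorem length_add_length_eq {g : CantorC → CantorC} {p q : BWord × BWord} {x : CantorC}
    (hp : ∀ y, g (wordApp p.2 y) = wordApp p.1 y) (hq : ∀ y, g (wordApp q.2 y) = wordApp q.1 y)
    (hxp : x ∈ cyl p.2) (hxq : x ∈ cyl q.2) :
    p.1.length + q.2.length = q.1.length + p.2.length := by
  wlog hle : p.2.length ≤ q.2.length generalizing p q
  · exact (this hq hp hxq hxp (le_of_not_ge hle)).symm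
  set N := p.1.length + q.1.length + q.2.length with hN
  let y : CantorC := fun k => decide (k = N - q.1.length)
  have key : wordApp p.1 (fun n => wordApp q.2 y (n + p.2.length)) N = wordApp q.1 y N := by
    rw [← hp, wordApp_shift_of_mem_cyl (wordApp_mem_cyl_of_length_le hxp hxq hle y), hq]
  rw [wordApp_of_le (by omega), wordApp_of_le (by omega), wordApp_of_le (by omega)] at key
  have : N - p.1.length + p.2.length - q.2.length = N - q.1.length := by
    simpa [y] using key
  omega

theorem evenPair_iff_of_mem_cyl {g : CantorC → CantorC} {p q : BWord × BWord} {x : CantorC}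
    (hp : ∀ y, g (wordApp p.2 y) = wordApp p.1 y) (hq : ∀ y, g (wordApp q.2 y) = wordApp q.1 y)
    (hxp : x ∈ cyl p.2) (hxq : x ∈ cyl q.2) : EvenPair p ↔ EvenPair q := by
  have := length_add_length_eq hp hq hxp hxq
  unfold EvenPair
  omega

theorem eSet_subset_eSet {g : Equiv.Perm CantorC} {J K : Finset (BWord × BWord)}
    (hJ : InducedBy J g) (hK : IsCode K) (hKg : InducedBy K g) : eSet J ⊆ eSet K := by
  rintro x ⟨p, hpJ, hp, hxp⟩
  obtain ⟨q, ⟨hqK, hxq⟩, -⟩ := hK.2 x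
  exact ⟨q, hqK, (evenPair_iff_of_mem_cyl (hJ p hpJ) (hKg q hqK) hxp hxq).1 hp, hxq⟩

theorem pSet_eq_image_eSet {g : Equiv.Perm CantorC} {J : Finset (BWord × BWord)}
    (hJ : InducedBy J g) : pSet J = g '' eSet J := by
  ext x
  constructor
  · rintro ⟨p, hpJ, hp, z, rfl⟩
    exact ⟨wordApp p.2 z, ⟨p, hpJ, hp, z, rfl⟩, hJ p hpJ z⟩
  · rintro ⟨_, ⟨p, hpJ, hp, z, rfl⟩, rfl⟩
    exact ⟨p, hpJ, hp, z, (hJ p hpJ z).symm⟩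

/-- two order-preserving codes for the same bijection give the same sets
`p_f` and `E_f`, so these depend only on the element of `F`. -/
theorem stmt3 (g : Equiv.Perm CantorC) (J K : Finset (BWord × BWord))
    (hJ : IsCodeFor J g) (hK : IsCodeFor K g) :
    pSet J = pSet K ∧ eSet J = eSet K := by
  have he : eSet J = eSet K :=
    (eSet_subset_eSet hJ.2.2 hK.1 hK.2.2).antisymm (eSet_subset_eSet hK.2.2 hJ.1 hJ.2.2)
  exact ⟨by rw [pSet_eq_image_eSet hJ.2.2, pSet_eq_image_eSet hK.2.2, he], he⟩
end
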